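/- Let d ≥ 1 and let f be a probability density on the torus [0,1]^d (nonnegative, measurable, extended 1-periodically to ℝ^d, with ∫_{[0,1]^d} f = 1) such that ∫_{[0,1]^d} f(x) ln^2 f(x) dx < ∞, with associated probability measure μ. Define m(x) = sup_{0 < ρ ≤ 1/2} μ(B(x,ρ)) / λ(B(x,ρ)), where B(x,ρ) is the closed ball of radius ρ in the torus metric and λ is Lebesgue measure. Then there exists a constant C depending only on d such that ∫_{[0,1]^d} f(x) ln^2( m(x) + 1 ) dx ≤ C ( 1 + ∫_{[0,1]^d} f(x) ln^2 f(x) dx ). -/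

import Mathlib

open MeasureTheory Real

noncomputable section

abbrev Euc (d : ℕ) : Type := EuclideanSpace ℝ (Fin d)

/-- The unit cube `[0,1]^d`. -/
def unitCube (d : ℕ) : Set (Euc d) := {x | ∀ i, x i ∈ Set.Icc (0:ℝ) 1}

/-- Volume of the unit Euclidean ball in `ℝ^d`. -/
def unitBallVol (d : ℕ) : ℝ := Real.pi ^ ((d : ℝ) / 2) / Real.Gamma (1 + (d : ℝ) / 2)

/-- The point of `ℝ^d` with integer coordinates `m`. -/
def intVec (d : ℕ) (m : Fin d → ℤ) : Euc d :=
  (WithLp.equiv 2 (Fin d → ℝ)).symm fun i => (m i : ℝ)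

/-- Torus distance: `d(x,y) = min_{m ∈ ℤ^d} ‖x + m - y‖`. -/
def torusDist (d : ℕ) (x y : Euc d) : ℝ :=
  ⨅ m : Fin d → ℤ, ‖x + intVec d m - y‖

/-- `(s,L)`-Hölder condition for `s ∈ (0,2]`. -/
def IsHolderOrder (d : ℕ) (s L : ℝ) (f : Euc d → ℝ) : Prop :=
  if s ≤ 1 then
    ∀ x y : Euc d, |f x - f y| ≤ L * ‖x - y‖ ^ s
  else
    ContDiff ℝ 1 f ∧ ∀ x y : Euc d, ‖gradient f x - gradient f y‖ ≤ L * ‖x - y‖ ^ (s - 1)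

/-- `f` is 1-periodic in each coordinate. -/
def IsPeriodic (d : ℕ) (f : Euc d → ℝ) : Prop :=
  ∀ (x : Euc d) (i : Fin d), f (x + EuclideanSpace.single i 1) = f x

/-- Probability density in the Hölder ball `H^s_d(L;[0,1]^d)`, represented by its
1-periodic extension to `ℝ^d`. -/
def HolderDensity (d : ℕ) (s L : ℝ) (f : Euc d → ℝ) : Prop :=
  IsHolderOrder d s L f ∧ IsPeriodic d f ∧ (∀ x, 0 ≤ f x) ∧
    (∫ x in unitCube d, f x) = 1

/-- The probability measure on `[0,1]^d` with density `f`. -/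
def densityMeasure (d : ℕ) (f : Euc d → ℝ) : Measure (Euc d) :=
  (volume.restrict (unitCube d)).withDensity fun x => ENNReal.ofReal (f x)

/-- Law of `n` i.i.d. samples from density `f`. -/
def sampleMeasure (d n : ℕ) (f : Euc d → ℝ) : Measure (Fin n → Euc d) :=
  Measure.pi fun _ => densityMeasure d f

/-- The `k`-th smallest element (1-indexed) of a multiset of reals. -/
def kthSmallest (s : Multiset ℝ) (k : ℕ) : ℝ :=
  (s.sort (· ≤ ·)).getD (k - 1) 0

/-- `R_{i,k}`: the `k`-nearest neighbor torus distance from `X i` to the other points. -/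
def nnDist (d n : ℕ) (X : Fin n → Euc d) (i : Fin n) (k : ℕ) : ℝ :=
  kthSmallest ((Finset.univ.erase i).val.map fun j => torusDist d (X i) (X j)) k

/-- The digamma function: derivative of `ln Γ`. -/
def digamma (x : ℝ) : ℝ := deriv (fun y => Real.log (Real.Gamma y)) x

/-- The Kozachenko–Leonenko `k`-nearest neighbor differential entropy estimator. -/
def klEstimator (d k n : ℕ) (X : Fin n → Euc d) : ℝ :=
  Real.log k - digamma k +
    (1 / n : ℝ) * ∑ i : Fin n, Real.log ((n / k : ℝ) * (unitBallVol d * nnDist d n X i k ^ d))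

/-- Differential entropy `h(f) = -∫_{[0,1]^d} f ln f`. -/
def diffEntropy (d : ℕ) (f : Euc d → ℝ) : ℝ :=
  -∫ x in unitCube d, f x * Real.log (f x)

end

noncomputable section

open ENNReal

/-- The closed ball of radius `ρ` around `x` in the torus metric. -/
def torusBall (d : ℕ) (x : Euc d) (ρ : ℝ) : Set (Euc d) := {y | torusDist d x y ≤ ρ}

/-- `ln²(M + 1)` for `M ∈ [0,∞]`, valued in `[0,∞]` (equal to `∞` when `M = ∞`). -/
def lnSqE (M : ℝ≥0∞) : ℝ≥0∞ :=
  if M = ∞ then ∞ else ENNReal.ofReal (Real.log (M.toReal + 1) ^ 2)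

/-- The maximal function `m(x) = sup_{0 < ρ ≤ 1/2} μ(B(x,ρ))/λ(B(x,ρ))`, where `B(x,ρ)`
is the torus ball, `μ` is the measure with density `f` and `λ` Lebesgue measure on the torus. -/
def maximalMuOverLambda (d : ℕ) (f : Euc d → ℝ) (x : Euc d) : ℝ≥0∞ :=
  ⨆ ρ ∈ Set.Ioc (0 : ℝ) (1/2 : ℝ),
    densityMeasure d f (torusBall d x ρ) / (volume.restrict (unitCube d)) (torusBall d x ρ)

theorem isClosed_unitCube (d : ℕ) : IsClosed (unitCube d) := by
  have h : unitCube d = ⋂ i, (fun x : Euc d => x i) ⁻¹' Set.Icc (0 : ℝ) 1 := by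
    ext x; simp [unitCube]
  rw [h]
  exact isClosed_iInter fun i => isClosed_Icc.preimage (by fun_prop)

theorem norm_le_of_abs_apply_le_one {d : ℕ} {v : Euc d} (hv : ∀ i, |v i| ≤ 1) : ‖v‖ ≤ d := by
  rw [EuclideanSpace.norm_eq]
  refine Real.sqrt_le_iff.2 ⟨by positivity, ?_⟩
  calc ∑ i, ‖v i‖ ^ 2 ≤ ∑ _i : Fin d, (1 : ℝ) :=
        Finset.sum_le_sum fun i _ => pow_le_one₀ (norm_nonneg _) (hv i)
    _ = d := by simp
    _ ≤ (d : ℝ) ^ 2 := by exact_mod_cast Nat.le_self_pow two_ne_zero d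

theorem volume_unitCube_lt_top (d : ℕ) : volume (unitCube d) < ∞ := by
  refine (measure_mono fun x hx => ?_).trans_lt
    (measure_closedBall_lt_top (μ := volume) (x := (0 : Euc d)) (r := d))
  rw [mem_closedBall_zero_iff]
  exact norm_le_of_abs_apply_le_one fun i => abs_le.2 ⟨by linarith [(hx i).1], (hx i).2⟩

theorem measurableSet_torusBall (d : ℕ) (x : Euc d) (ρ : ℝ) : MeasurableSet (torusBall d x ρ) := by
  have h : Measurable fun y => torusDist d x y := by
    unfold torusDist
    exact Measurable.iInf fun m => by fun_prop
  exact measurableSet_le h measurable_const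

theorem torusDist_le_norm (d : ℕ) (x y : Euc d) (m : Fin d → ℤ) :
    torusDist d x y ≤ ‖x + intVec d m - y‖ :=
  ciInf_le ⟨0, by rintro _ ⟨m, rfl⟩; exact norm_nonneg _⟩ m

theorem torusDist_le_norm_sub (d : ℕ) (x y : Euc d) : torusDist d x y ≤ ‖x - y‖ := by
  have h : intVec d 0 = 0 := by ext i; simp [intVec]
  simpa [h] using torusDist_le_norm d x y 0

/-- A point of the cube sees a fixed proportion of each small ball around it inside the cube. -/
theorem exists_closedBall_subset_torusBall {d : ℕ} (hd : 1 ≤ d) {x : Euc d} (hx : x ∈ unitCube d)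
    {ρ : ℝ} (hρ : ρ ∈ Set.Ioc (0 : ℝ) (1 / 2)) :
    ∃ c, Metric.closedBall c (ρ / (4 * d)) ⊆ torusBall d x ρ ∩ unitCube d := by
  have hd' : (1 : ℝ) ≤ d := by exact_mod_cast hd
  obtain ⟨h0, h1⟩ := hρ
  set θ : ℝ := ρ / (2 * d) with hθ
  have hθ0 : 0 < θ := by positivity
  have hθρ : θ * (2 * d) = ρ := by rw [hθ]; field_simp
  have hθ1 : θ * 2 ≤ ρ := by nlinarith
  have hr : ρ / (4 * d) = θ / 2 := by rw [hθ]; field_simp; norm_num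
  let v : Euc d := WithLp.toLp 2 fun i => 1 / 2 - x i
  have hv : ‖v‖ ≤ d := norm_le_of_abs_apply_le_one fun i => by
    have := hx i
    simp only [v]
    rw [abs_le]; constructor <;> linarith [this.1, this.2]
  refine ⟨x + θ • v, fun y hy => ?_⟩
  rw [hr, Metric.mem_closedBall, dist_eq_norm] at hy
  constructor
  · refine (torusDist_le_norm_sub d x y).trans ?_
    calc ‖x - y‖ = ‖-(θ • v) - (y - (x + θ • v))‖ := by congr 1; abel
      _ ≤ ‖-(θ • v)‖ + ‖y - (x + θ • v)‖ := norm_sub_le _ _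
      _ ≤ θ * d + θ / 2 := by
        rw [norm_neg, norm_smul, Real.norm_of_nonneg hθ0.le]
        gcongr
      _ ≤ ρ := by nlinarith
  · intro i
    have h2 := (PiLp.norm_apply_le (y - (x + θ • v)) i).trans hy
    simp only [PiLp.sub_apply, PiLp.add_apply, PiLp.smul_apply, smul_eq_mul, v,
      Real.norm_eq_abs, abs_le] at h2
    have := (hx i).1
    have := (hx i).2
    have : θ ≤ 1 := by linarith
    constructor <;> nlinarith

theorem exists_norm_lt_of_mem_torusBall {d : ℕ} {x y : Euc d} {ρ r : ℝ}
    (h : y ∈ torusBall d x ρ) (hr : ρ < r) : ∃ m, ‖x + intVec d m - y‖ < r :=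
  exists_lt_of_ciInf_lt (lt_of_le_of_lt h hr)

/-- Integer vectors with entries of absolute value at most `3`. -/
def smallInts (d : ℕ) : Finset (Fin d → ℤ) := Fintype.piFinset fun _ => Finset.Icc (-3) 3

theorem mem_closedBall_of_torusBall_inter {d : ℕ} {x y : Euc d} (hx : x ∈ unitCube d)
    (hy : y ∈ unitCube d) {ρ σ : ℝ} (hσ : σ ≤ 2 * ρ) (hρ : ρ ∈ Set.Ioc (0 : ℝ) (1 / 2))
    (h : (torusBall d y σ ∩ torusBall d x ρ).Nonempty) :
    y ∈ ⋃ k ∈ smallInts d, Metric.closedBall (x + intVec d k) (4 * ρ) := by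
  obtain ⟨z, hzy, hzx⟩ := h
  obtain ⟨h0, h1⟩ := hρ
  obtain ⟨n, hn⟩ := exists_norm_lt_of_mem_torusBall hzy (show σ < 5 / 2 * ρ by linarith)
  obtain ⟨m, hm⟩ := exists_norm_lt_of_mem_torusBall hzx (show ρ < 3 / 2 * ρ by linarith)
  have hk : intVec d (m - n) = intVec d m - intVec d n := by ext i; simp [intVec]
  have hle : ‖y - (x + intVec d (m - n))‖ ≤ 4 * ρ := by
    calc ‖y - (x + intVec d (m - n))‖
        = ‖(y + intVec d n - z) - (x + intVec d m - z)‖ := by rw [hk]; congr 1; abel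
      _ ≤ _ := norm_sub_le _ _
      _ ≤ 4 * ρ := by linarith
  refine Set.mem_biUnion (x := m - n) ?_ (by rwa [Metric.mem_closedBall, dist_eq_norm])
  simp only [smallInts, Finset.mem_coe, Fintype.mem_piFinset, Finset.mem_Icc]
  intro i
  have h2 := (PiLp.norm_apply_le (y - (x + intVec d (m - n))) i).trans hle
  have h3 : intVec d (m - n) i = ((m - n) i : ℤ) := rfl
  simp only [PiLp.sub_apply, PiLp.add_apply, Real.norm_eq_abs, abs_le, h3] at h2
  have hxi := hx i
  have hyi := hy i
  constructor
  · have : (-3 : ℝ) ≤ ((m - n) i : ℤ) := by linarith [hxi.1, hxi.2, hyi.1, hyi.2, h2.1, h2.2]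
    exact_mod_cast this
  · have : (((m - n) i : ℤ) : ℝ) ≤ 3 := by linarith [hxi.1, hxi.2, hyi.1, hyi.2, h2.1, h2.2]
    exact_mod_cast this

theorem volume_torusBall_pos {d : ℕ} (hd : 1 ≤ d) {x : Euc d} (hx : x ∈ unitCube d)
    {ρ : ℝ} (hρ : ρ ∈ Set.Ioc (0 : ℝ) (1 / 2)) :
    0 < (volume.restrict (unitCube d)) (torusBall d x ρ) := by
  obtain ⟨c, hc⟩ := exists_closedBall_subset_torusBall hd hx hρ
  have hd' : (0 : ℝ) < d := by exact_mod_cast hd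
  rw [Measure.restrict_apply (measurableSet_torusBall d x ρ)]
  exact (Metric.measure_closedBall_pos volume c (div_pos hρ.1 (by positivity))).trans_le
    (measure_mono hc)

theorem volume_iUnion_closedBall_le {d : ℕ} (hd : 1 ≤ d) {x : Euc d} (hx : x ∈ unitCube d)
    {ρ : ℝ} (hρ : ρ ∈ Set.Ioc (0 : ℝ) (1 / 2)) :
    volume (⋃ k ∈ smallInts d, Metric.closedBall (x + intVec d k) (4 * ρ)) ≤
      (((112 * d) ^ d : ℕ) : ℝ≥0∞) * (volume.restrict (unitCube d)) (torusBall d x ρ) := by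
  obtain ⟨c, hc⟩ := exists_closedBall_subset_torusBall hd hx hρ
  have hd' : (0 : ℝ) < d := by exact_mod_cast hd
  have h0 := hρ.1
  have hcard : (smallInts d).card = 7 ^ d := by simp [smallInts]
  have hrad : (4 * ρ) = (16 * d : ℝ) * (ρ / (4 * d)) := by field_simp; norm_num
  calc volume (⋃ k ∈ smallInts d, Metric.closedBall (x + intVec d k) (4 * ρ))
      ≤ ∑ k ∈ smallInts d, volume (Metric.closedBall (x + intVec d k) (4 * ρ)) :=
        measure_biUnion_finset_le _ _
    _ = (((112 * d) ^ d : ℕ) : ℝ≥0∞) * volume (Metric.closedBall c (ρ / (4 * d))) := by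
        have hball : ∀ k, volume (Metric.closedBall (x + intVec d k) (4 * ρ)) =
            (((16 * d) ^ d : ℕ) : ℝ≥0∞) * volume (Metric.closedBall c (ρ / (4 * d))) := by
          intro k
          rw [Measure.addHaar_closedBall _ _ (by positivity),
            Measure.addHaar_closedBall _ _ (by positivity), ← mul_assoc, finrank_euclideanSpace,
            Fintype.card_fin, hrad, mul_pow, ENNReal.ofReal_mul (by positivity)]
          congr 2
          rw [← ENNReal.ofReal_natCast]
          push_cast
          rfl
        simp only [hball, Finset.sum_const, hcard, nsmul_eq_mul, ← mul_assoc]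
        congr 1
        rw [show 112 * d = 7 * (16 * d) by ring, mul_pow 7]
        push_cast
        rfl
    _ ≤ _ := by
        rw [Measure.restrict_apply (measurableSet_torusBall d x ρ)]
        gcongr

/-- Weak type `(1,1)` estimate for the torus maximal function. -/
theorem mul_volume_lt_maximalMuOverLambda_le {d : ℕ} (hd : 1 ≤ d) {f : Euc d → ℝ}
    (hf : densityMeasure d f Set.univ ≤ 1) (t : ℝ≥0∞) :
    t * (volume.restrict (unitCube d)) {x | t < maximalMuOverLambda d f x} ≤
      (((112 * d) ^ d : ℕ) : ℝ≥0∞) := by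
  set μ := densityMeasure d f
  set K : ℝ≥0∞ := (((112 * d) ^ d : ℕ) : ℝ≥0∞)
  set lam := volume.restrict (unitCube d) with hlam
  set E := {x | t < maximalMuOverLambda d f x} ∩ unitCube d
  have hρ : ∀ x : Euc d, ∃ ρ : ℝ, x ∈ E → ρ ∈ Set.Ioc (0 : ℝ) (1 / 2) ∧
      t * lam (torusBall d x ρ) < μ (torusBall d x ρ) := by
    intro x
    by_cases hx : x ∈ E
    · have h := hx.1
      simp only [Set.mem_ofPred_eq, maximalMuOverLambda, lt_iSup_iff] at h
      obtain ⟨ρ, hρ, h⟩ := h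
      exact ⟨ρ, fun _ => ⟨hρ, ENNReal.mul_lt_of_lt_div h⟩⟩
    · exact ⟨0, fun h => absurd h hx⟩
  choose ρ hρ using hρ
  obtain ⟨u, huE, hdisj, hcov⟩ := Vitali.exists_disjoint_subfamily_covering_enlargement
    (fun x => torusBall d x (ρ x)) E ρ 2 one_lt_two (fun x hx => (hρ x hx).1.1.le) (1 / 2)
    (fun x hx => (hρ x hx).1.2)
    (fun x hx => nonempty_of_measure_ne_zero (hρ x hx).2.ne_bot)
  have hmeas : ∀ x, MeasurableSet (torusBall d x (ρ x)) := fun x => measurableSet_torusBall d x _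
  have hdisj' : Pairwise (Function.onFun Disjoint fun x : u => torusBall d x (ρ x)) :=
    fun x y hxy => hdisj x.2 y.2 (Subtype.coe_injective.ne hxy)
  have hcount : Countable u := by
    have h := Measure.countable_meas_pos_of_disjoint_of_meas_iUnion_ne_top μ
      (fun x : u => hmeas x) hdisj'
      (((measure_mono (Set.subset_univ _)).trans hf).trans_lt ENNReal.one_lt_top).ne
    have huniv : {x : u | 0 < μ (torusBall d x (ρ x))} = Set.univ :=
      Set.eq_univ_of_forall fun x => bot_le.trans_lt (hρ x (huE x.2)).2
    rw [huniv] at h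
    exact Set.countable_univ_iff.1 h
  have hsub : E ⊆ ⋃ x : u, ⋃ k ∈ smallInts d,
      Metric.closedBall ((x : Euc d) + intVec d k) (4 * ρ x) := by
    intro y hy
    obtain ⟨x, hx, hne, hle⟩ := hcov y hy
    exact Set.mem_iUnion.2 ⟨⟨x, hx⟩, mem_closedBall_of_torusBall_inter (huE hx).2 hy.2 hle
      (hρ x (huE hx)).1 hne⟩
  rw [hlam, Measure.restrict_apply' (isClosed_unitCube d).measurableSet]
  calc t * volume E
      ≤ t * ∑' x : u, K * lam (torusBall d x (ρ x)) := by
        gcongr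
        refine (measure_mono hsub).trans ((measure_iUnion_le _).trans ?_)
        exact ENNReal.tsum_le_tsum fun x =>
          volume_iUnion_closedBall_le hd (huE x.2).2 (hρ x (huE x.2)).1
    _ = K * ∑' x : u, t * lam (torusBall d x (ρ x)) := by
        rw [ENNReal.tsum_mul_left, ENNReal.tsum_mul_left]; ring
    _ ≤ K * ∑' x : u, μ (torusBall d x (ρ x)) := by
        gcongr with x
        exact (hρ x (huE x.2)).2.le
    _ = K * μ (⋃ x : u, torusBall d x (ρ x)) := by
        rw [measure_iUnion hdisj' fun x => hmeas x]
    _ ≤ K * 1 := by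
        gcongr
        exact (measure_mono (Set.subset_univ _)).trans hf
    _ = K := mul_one K

theorem mul_sq_log_le {a y z : ℝ} (ha : 0 ≤ a) (hy : 1 ≤ y) (hz : 0 ≤ z) (hyz : y ^ 3 ≤ z ^ 4) :
    a * log y ^ 2 ≤ 4 * (a * log a ^ 2) + 64 * z := by
  obtain ⟨s, hs, rfl⟩ : ∃ s : ℝ, 0 < s ∧ s ^ 8 = y :=
    ⟨y ^ (1 / 8 : ℝ), by positivity, by rw [← Real.rpow_mul_natCast (by linarith)]; norm_num⟩
  have hs1 : 1 ≤ s := (one_le_pow_iff_of_nonneg hs.le (by norm_num)).1 hy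
  have hlog0 : 0 ≤ log s := Real.log_nonneg hs1
  have hlog : Real.log (s ^ 8) = 8 * log s := by rw [Real.log_pow]; norm_num
  rw [hlog]
  rcases le_or_gt (s ^ 4) a with h | h
  · have h4 : 4 * log s ≤ log a := by
      have := Real.log_le_log (by positivity) h
      rwa [Real.log_pow] at this
    have : (8 * log s) ^ 2 ≤ 4 * log a ^ 2 := by nlinarith
    nlinarith [mul_le_mul_of_nonneg_left this ha]
  · have hls : log s ≤ s := (Real.log_le_sub_one_of_pos hs).trans (by linarith)
    have h6 : s ^ 6 ≤ z := by
      refine (pow_le_pow_iff_left₀ (by positivity) hz (n := 4) (by norm_num)).1 ?_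
      calc (s ^ 6) ^ 4 = (s ^ 8) ^ 3 := by ring
        _ ≤ z ^ 4 := hyz
    have : a * (8 * log s) ^ 2 ≤ s ^ 4 * (8 * s) ^ 2 := by gcongr
    nlinarith [mul_nonneg ha (sq_nonneg (log a))]

/-- Dyadic majorant of `(M + 1) ^ (3 / 4)`. -/
def dyadicMajorant (M : ℝ≥0∞) : ℝ≥0∞ :=
  2 + ∑' k : ℕ, if 16 ^ k / 2 < M then 16 * 8 ^ k else 0

theorem dyadicMajorant_top : dyadicMajorant ∞ = ∞ := by
  have h : ∀ k : ℕ, (16 : ℝ≥0∞) ^ k / 2 < ∞ := fun k =>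
    ENNReal.div_lt_top (by finiteness) (by norm_num)
  simp only [dyadicMajorant, h, if_true]
  refine ENNReal.add_eq_top.2 (Or.inr (top_unique ?_))
  rw [← ENNReal.tsum_const_eq_top_of_ne_zero (α := ℕ) (c := 16) (by norm_num)]
  exact ENNReal.tsum_le_tsum fun k => le_mul_of_one_le_right' (one_le_pow₀ (by norm_num))

theorem exists_ofReal_le_dyadicMajorant {m : ℝ} (hm : 0 ≤ m) :
    ∃ z : ℝ, 0 ≤ z ∧ (m + 1) ^ 3 ≤ z ^ 4 ∧
      ENNReal.ofReal z ≤ dyadicMajorant (ENNReal.ofReal m) := by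
  rcases lt_or_ge m 1 with h | h
  · refine ⟨2, by norm_num, ?_, ?_⟩
    · calc (m + 1) ^ 3 ≤ (1 + 1) ^ 3 := by gcongr
        _ ≤ 2 ^ 4 := by norm_num
    · rw [ENNReal.ofReal_ofNat]
      exact le_self_add
  · obtain ⟨k, hk1, hk2⟩ := exists_nat_pow_near h (show (1 : ℝ) < 16 by norm_num)
    refine ⟨16 * 8 ^ k, by positivity, ?_, ?_⟩
    · calc (m + 1) ^ 3 ≤ (2 * 16 ^ (k + 1)) ^ 3 := by gcongr; linarith
        _ = 8 * 16 ^ 3 * (16 ^ 3) ^ k := by rw [mul_pow, ← pow_mul, ← pow_mul]; ring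
        _ ≤ 16 ^ 4 * (8 ^ 4) ^ k := by norm_num
        _ = (16 * 8 ^ k) ^ 4 := by rw [mul_pow, ← pow_mul, ← pow_mul, mul_comm k]
    · have hlt : (16 : ℝ≥0∞) ^ k / 2 < ENNReal.ofReal m := by
        have : (16 : ℝ≥0∞) ^ k / 2 = ENNReal.ofReal (16 ^ k / 2) := by
          rw [ENNReal.ofReal_div_of_pos (by norm_num), ENNReal.ofReal_pow (by norm_num)]
          simp
        rw [this, ENNReal.ofReal_lt_ofReal_iff (by linarith)]
        have : (0 : ℝ) < 16 ^ k := by positivity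
        linarith
      have hz : ENNReal.ofReal (16 * 8 ^ k) = 16 * 8 ^ k := by
        rw [ENNReal.ofReal_mul (by norm_num), ENNReal.ofReal_pow (by norm_num)]
        simp
      rw [hz]
      refine le_trans ?_ le_add_self
      refine le_trans ?_ (ENNReal.le_tsum k)
      rw [if_pos hlt]

theorem ofReal_mul_lnSqE_le {a : ℝ} (ha : 0 ≤ a) (M : ℝ≥0∞) :
    ENNReal.ofReal a * lnSqE M ≤
      ENNReal.ofReal (4 * (a * log a ^ 2)) + 64 * dyadicMajorant M := by
  by_cases hM : M = ∞
  · rw [hM, dyadicMajorant_top, ENNReal.mul_top (by norm_num), add_top]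
    exact le_top
  obtain ⟨z, hz, hyz, hle⟩ := exists_ofReal_le_dyadicMajorant (ENNReal.toReal_nonneg (a := M))
  rw [ENNReal.ofReal_toReal hM] at hle
  rw [lnSqE, if_neg hM, ← ENNReal.ofReal_mul ha]
  calc ENNReal.ofReal (a * Real.log (M.toReal + 1) ^ 2)
      ≤ ENNReal.ofReal (4 * (a * log a ^ 2) + 64 * z) :=
        ENNReal.ofReal_le_ofReal
          (mul_sq_log_le ha (by linarith [ENNReal.toReal_nonneg (a := M)]) hz hyz)
    _ = ENNReal.ofReal (4 * (a * log a ^ 2)) + 64 * ENNReal.ofReal z := by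
        rw [ENNReal.ofReal_add (by positivity) (by positivity), ENNReal.ofReal_mul (by norm_num :
          (0 : ℝ) ≤ 64), ENNReal.ofReal_ofNat]
    _ ≤ ENNReal.ofReal (4 * (a * log a ^ 2)) + 64 * dyadicMajorant M := by gcongr

/-- A function satisfying a weak type `L¹` bound has integrable dyadic majorant. -/
theorem lintegral_dyadicMajorant_le {α : Type*} [MeasurableSpace α] (μ : Measure α)
    {M : α → ℝ≥0∞} {K : ℝ≥0∞} (hM : ∀ t : ℝ≥0∞, t * μ {x | t < M x} ≤ K) :
    ∫⁻ x, dyadicMajorant (M x) ∂μ ≤ 2 * μ Set.univ + 64 * K := by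
  set E : ℕ → Set α := fun k => toMeasurable μ {x | 16 ^ k / 2 < M x}
  have hE : ∀ k, MeasurableSet (E k) := fun k => measurableSet_toMeasurable _ _
  have hle : ∀ x, dyadicMajorant (M x) ≤
      2 + ∑' k, (E k).indicator (fun _ => (16 * 8 ^ k : ℝ≥0∞)) x := by
    intro x
    refine add_le_add_right (ENNReal.tsum_le_tsum fun k => ?_) _
    split_ifs with h
    · rw [Set.indicator_of_mem (subset_toMeasurable μ _ h)]
    · exact zero_le
  calc ∫⁻ x, dyadicMajorant (M x) ∂μ
      ≤ ∫⁻ x, 2 + ∑' k, (E k).indicator (fun _ => (16 * 8 ^ k : ℝ≥0∞)) x ∂μ := lintegral_mono hle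
    _ = 2 * μ Set.univ + ∑' k : ℕ, 16 * 8 ^ k * μ {x | 16 ^ k / 2 < M x} := by
        rw [lintegral_add_left measurable_const, lintegral_const, lintegral_tsum fun k =>
          (measurable_const.indicator (hE k)).aemeasurable]
        simp only [lintegral_indicator_const (hE _), E, measure_toMeasurable]
    _ ≤ 2 * μ Set.univ + ∑' k : ℕ, 32 * K * 2⁻¹ ^ k := by
        refine add_le_add_right (ENNReal.tsum_le_tsum fun k => ?_) _
        have h16 : (16 : ℝ≥0∞) * 8 ^ k = 32 * 2⁻¹ ^ k * (16 ^ k / 2) := by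
          have h2 : (16 : ℝ≥0∞) ^ k = 2 ^ k * 8 ^ k := by rw [← mul_pow]; norm_num
          have h3 : (2⁻¹ : ℝ≥0∞) ^ k * 2 ^ k = 1 := by
            rw [← mul_pow, ENNReal.inv_mul_cancel (by norm_num) (by norm_num), one_pow]
          have h4 : (32 : ℝ≥0∞) * 2⁻¹ = 16 := by
            rw [show (32 : ℝ≥0∞) = 16 * 2 by norm_num, mul_assoc,
              ENNReal.mul_inv_cancel (by norm_num) (by norm_num), mul_one]
          calc (16 : ℝ≥0∞) * 8 ^ k = 32 * 2⁻¹ * (2⁻¹ ^ k * 2 ^ k) * 8 ^ k := by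
                rw [h3, h4, mul_one]
            _ = _ := by rw [h2, div_eq_mul_inv]; ring
        rw [h16, mul_assoc]
        calc 32 * 2⁻¹ ^ k * (16 ^ k / 2 * μ {x | 16 ^ k / 2 < M x})
            ≤ 32 * 2⁻¹ ^ k * K := by gcongr; exact hM _
          _ = _ := by ring
    _ = 2 * μ Set.univ + 64 * K := by
        rw [ENNReal.tsum_mul_left, ENNReal.tsum_geometric_two]; ring

theorem densityMeasure_univ_eq_one {d : ℕ} {f : Euc d → ℝ} (hf0 : ∀ x, 0 ≤ f x)
    (hf1 : (∫ x in unitCube d, f x) = 1) : densityMeasure d f Set.univ = 1 := by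
  have hint : Integrable f (volume.restrict (unitCube d)) := by
    by_contra h
    rw [integral_undef h] at hf1
    exact zero_ne_one hf1
  rw [densityMeasure, withDensity_apply _ MeasurableSet.univ, Measure.restrict_univ,
    ← ofReal_integral_eq_lintegral_ofReal hint (Filter.Eventually.of_forall hf0), hf1,
    ENNReal.ofReal_one]

/-- If `∫ f ln² f < ∞` then
`∫_{[0,1]^d} f(x) ln²(m(x)+1) dx ≤ C (1 + ∫ f ln² f)` with `C` depending only on `d`. -/
theorem lintegral_sq_log_maximal_density_le (d : ℕ) (hd : 1 ≤ d) :
    ∃ C : ℝ, 0 < C ∧ ∀ f : Euc d → ℝ, Measurable f → (∀ x, 0 ≤ f x) →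
      IsPeriodic d f → (∫ x in unitCube d, f x) = 1 →
      Integrable (fun x => f x * Real.log (f x) ^ 2) (volume.restrict (unitCube d)) →
      (∫⁻ x in unitCube d, ENNReal.ofReal (f x) * lnSqE (maximalMuOverLambda d f x))
        ≤ ENNReal.ofReal (C * (1 + ∫ x in unitCube d, f x * Real.log (f x) ^ 2)) := by
  set V : ℝ := (volume (unitCube d)).toReal
  set K : ℕ := (112 * d) ^ d
  have hV : 0 ≤ V := ENNReal.toReal_nonneg
  refine ⟨4 + 64 * (2 * V + 64 * K), by positivity, fun f hf hf0 _ hf1 hint => ?_⟩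
  set I := ∫ x in unitCube d, f x * log (f x) ^ 2
  have hI : 0 ≤ I := integral_nonneg fun x => mul_nonneg (hf0 x) (sq_nonneg _)
  have hweak := mul_volume_lt_maximalMuOverLambda_le hd (densityMeasure_univ_eq_one hf0 hf1).le
  calc ∫⁻ x in unitCube d, ENNReal.ofReal (f x) * lnSqE (maximalMuOverLambda d f x)
      ≤ ∫⁻ x in unitCube d, ENNReal.ofReal (4 * (f x * log (f x) ^ 2)) +
          64 * dyadicMajorant (maximalMuOverLambda d f x) :=
        lintegral_mono fun x => ofReal_mul_lnSqE_le (hf0 x) _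
    _ = ENNReal.ofReal (4 * I) +
          64 * ∫⁻ x in unitCube d, dyadicMajorant (maximalMuOverLambda d f x) := by
        rw [lintegral_add_left (by fun_prop), lintegral_const_mul' _ _ (by norm_num),
          ← ofReal_integral_eq_lintegral_ofReal (hint.const_mul 4)
            (Filter.Eventually.of_forall fun x =>
              mul_nonneg (by norm_num) (mul_nonneg (hf0 x) (sq_nonneg _))),
          integral_const_mul]
    _ ≤ ENNReal.ofReal (4 * I) + 64 * (2 * volume (unitCube d) + 64 * (K : ℝ≥0∞)) := by
        gcongr
        simpa only [Measure.restrict_apply_univ] using lintegral_dyadicMajorant_le _ hweak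
    _ = ENNReal.ofReal (4 * I + 64 * (2 * V + 64 * K)) := by
        rw [ENNReal.ofReal_add (by positivity) (by positivity),
          ENNReal.ofReal_mul (by norm_num : (0 : ℝ) ≤ 64),
          ENNReal.ofReal_add (by positivity) (by positivity),
          ENNReal.ofReal_mul (by norm_num : (0 : ℝ) ≤ 2),
          ENNReal.ofReal_mul (by norm_num : (0 : ℝ) ≤ 64),
          ENNReal.ofReal_toReal (volume_unitCube_lt_top d).ne, ENNReal.ofReal_natCast]
        simp
    _ ≤ _ := by
        apply ENNReal.ofReal_le_ofReal
        have : 0 ≤ 64 * (2 * V + 64 * K) * I := by positivity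
        nlinarith

end
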